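/- arXiv:1211.4007 — 7 statements merged into one kernel-verified Lean document; each statement's English description precedes it below -/
import Mathlib

section
/- Let m≥1 and let F₁,…,F_m be integrable functions on (0,∞), each having property 𝒲. Then the convolution F₁*⋯*F_m also has property 𝒲. -/
open MeasureTheory Set

/-- Convolution of two real functions. -/
noncomputable def conv (F G : ℝ → ℝ) : ℝ → ℝ := fun x => ∫ y, F y * G (x - y)

/-- Iterated convolution of a list of functions. -/
noncomputable def multiConv : List (ℝ → ℝ) → (ℝ → ℝ)
  | [] => fun _ => 0
  | [f] => f
  | f :: g :: fs => conv f (multiConv (g :: fs))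

/-- Property `𝒲`: exponential decay at infinity and an integrable power
singularity at `0`. -/
def PropW (F : ℝ → ℝ) : Prop :=
  ∃ A : ℝ, 1 < A ∧ ∃ t : ℝ, 0 ≤ t ∧ ∃ r ∈ Set.Ioo (-1 : ℝ) 0,
    (∀ x : ℝ, t < |x| → |F x| < A * Real.exp (-|x| / A)) ∧
    (∀ x : ℝ, 0 < |x| → |x| < t → |F x| < A * |x| ^ r)

/-- `F` is bounded by `C * y ^ r * exp (-b * y)` at `y`, a multiple of a Gamma density. -/
def GammaBoundAt (C b r : ℝ) (F : ℝ → ℝ) (y : ℝ) : Prop :=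
  |F y| ≤ C * (y ^ r * Real.exp (-(b * y)))

/-- `F` vanishes on `(-∞, 0]` and is almost everywhere dominated by a multiple of a
Gamma density. -/
def GammaDominated (F : ℝ → ℝ) : Prop :=
  (∀ x ≤ (0 : ℝ), F x = 0) ∧ ∃ C b r : ℝ, 0 ≤ C ∧ 0 < b ∧ -1 < r ∧
    ∀ᵐ y, 0 < y → GammaBoundAt C b r F y

/-- Monotonicity of a Gamma bound in the decay rate. -/
theorem GammaBoundAt.mono_rate {C b b' r y : ℝ} {F : ℝ → ℝ} (h : GammaBoundAt C b r F y)
    (hC : 0 ≤ C) (hy : 0 < y) (hb : b' ≤ b) : GammaBoundAt C b' r F y := by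
  refine h.trans ?_
  gcongr

theorem rpow_le_mul_exp {p b : ℝ} (hp : 0 < p) (hb : 0 < b) {x : ℝ} (hx : 0 ≤ x) :
    x ^ p ≤ (p / b) ^ p * Real.exp (b * x) := by
  have h : b * x / p ≤ Real.exp (b * x / p) := by linarith [Real.add_one_le_exp (b * x / p)]
  calc x ^ p = (p / b * (b * x / p)) ^ p := by congr 1; field_simp
    _ = (p / b) ^ p * (b * x / p) ^ p := Real.mul_rpow (by positivity) (by positivity)
    _ ≤ (p / b) ^ p * Real.exp (b * x / p) ^ p := by gcongr
    _ = (p / b) ^ p * Real.exp (b * x) := by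
      rw [← Real.exp_mul, div_mul_cancel₀ _ hp.ne']

/-- A function with property `𝒲` supported on `(0, ∞)` is dominated by a Gamma density. -/
theorem PropW.gammaDominated {F : ℝ → ℝ} (hF : PropW F) (h0 : ∀ x ≤ (0 : ℝ), F x = 0) :
    GammaDominated F := by
  obtain ⟨A, hA, t, ht, r, ⟨hr, hr0⟩, hfar, hnear⟩ := hF
  have hA0 : 0 < A := by linarith
  set b := 1 / (2 * A) with hb
  have hb0 : 0 < b := by positivity
  set K := (-r / b) ^ (-r) with hK
  have hK0 : 0 ≤ K := Real.rpow_nonneg (div_nonneg (by linarith) hb0.le) _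
  refine ⟨h0, A * (K + Real.exp (b * t)), b, r, by positivity, hb0, hr, ?_⟩
  have hne : ∀ᵐ y : ℝ, y ≠ t := by simp [ae_iff]
  filter_upwards [hne] with y hyt hy
  have hpos : 0 < y ^ r := Real.rpow_pos_of_pos hy r
  unfold GammaBoundAt
  rcases lt_or_gt_of_ne hyt with h | h
  · have h1 := (hnear y (by rwa [abs_of_pos hy]) (by rwa [abs_of_pos hy])).le
    rw [abs_of_pos hy] at h1
    have h2 : 1 ≤ Real.exp (b * t) * Real.exp (-(b * y)) := by
      rw [← Real.exp_add]
      exact Real.one_le_exp (by nlinarith)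
    calc |F y| ≤ A * y ^ r * 1 := by simpa using h1
      _ ≤ A * y ^ r * (Real.exp (b * t) * Real.exp (-(b * y))) := by gcongr
      _ ≤ A * y ^ r * ((K + Real.exp (b * t)) * Real.exp (-(b * y))) := by
        gcongr
        linarith
      _ = _ := by ring
  · have h1 := (hfar y (by rwa [abs_of_pos hy])).le
    rw [abs_of_pos hy] at h1
    have h2 : 1 ≤ y ^ r * (K * Real.exp (b * y)) := by
      calc 1 = y ^ r * y ^ (-r) := by rw [← Real.rpow_add hy]; simp
        _ ≤ _ := by
          gcongr
          exact rpow_le_mul_exp (by linarith) hb0 hy.le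
    have h3 : Real.exp (-y / A) = Real.exp (-(b * y)) * Real.exp (-(b * y)) := by
      rw [← Real.exp_add]
      congr 1
      rw [hb]
      field_simp
      ring
    have h4 : Real.exp (b * y) * Real.exp (-(b * y)) = 1 := by
      rw [← Real.exp_add]; simp
    calc |F y| ≤ A * (Real.exp (-(b * y)) * Real.exp (-(b * y))) * 1 := by
          rw [← h3]; simpa using h1
      _ ≤ A * (Real.exp (-(b * y)) * Real.exp (-(b * y))) * (y ^ r * (K * Real.exp (b * y))) := by
        gcongr
      _ = A * K * (y ^ r * Real.exp (-(b * y))) * (Real.exp (b * y) * Real.exp (-(b * y))) := by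
        ring
      _ = A * K * (y ^ r * Real.exp (-(b * y))) := by rw [h4, mul_one]
      _ ≤ _ := by
        gcongr
        linarith [Real.exp_pos (b * t)]

/-- A function bounded everywhere on `(0, ∞)` by a Gamma density has property `𝒲`. -/
theorem PropW.of_gammaBoundAt {F : ℝ → ℝ} (h0 : ∀ x ≤ (0 : ℝ), F x = 0) {C b r : ℝ}
    (hC : 0 ≤ C) (hb : 0 < b) (hr : -1 < r) (h : ∀ y, 0 < y → GammaBoundAt C b r F y) :
    PropW F := by
  set p := max r 1 with hp
  have hp0 : 0 < p := lt_of_lt_of_le one_pos (le_max_right _ _)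
  set K := (p / (b / 2)) ^ p with hK
  have hK0 : 0 ≤ K := Real.rpow_nonneg (by positivity) _
  set A := 2 + 2 / b + C + C * K with hAdef
  have hCK : 0 ≤ C * K := by positivity
  have hb2 : 0 < 2 / b := by positivity
  have hA0 : 0 < A := by positivity
  refine ⟨A, by linarith, 1, zero_le_one, min r (-1 / 2),
    ⟨lt_min hr (by norm_num), (min_le_right _ _).trans_lt (by norm_num)⟩, ?_, ?_⟩
  · intro x hx
    rcases le_or_gt x 0 with hx0 | hx0
    · rw [h0 x hx0, abs_zero]
      positivity
    rw [abs_of_pos hx0] at hx ⊢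
    have h1 : x ^ r ≤ K * Real.exp (b / 2 * x) :=
      (Real.rpow_le_rpow_of_exponent_le hx.le (le_max_left _ _)).trans
        (rpow_le_mul_exp hp0 (by positivity) hx0.le)
    have h2 : Real.exp (-(b / 2 * x)) ≤ Real.exp (-x / A) := by
      apply Real.exp_le_exp.2
      have : 1 / A ≤ b / 2 := by
        rw [div_le_iff₀ hA0]
        have : b / 2 * (2 / b) = 1 := by field_simp
        nlinarith
      calc -(b / 2 * x) ≤ -(1 / A * x) := by gcongr
        _ = -x / A := by ring
    calc |F x| ≤ C * (x ^ r * Real.exp (-(b * x))) := h x hx0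
      _ ≤ C * (K * Real.exp (b / 2 * x) * Real.exp (-(b * x))) := by gcongr
      _ = C * K * Real.exp (-(b / 2 * x)) := by
        rw [mul_assoc K, ← Real.exp_add, mul_assoc]
        congr 4
        ring
      _ ≤ C * K * Real.exp (-x / A) := by gcongr
      _ < A * Real.exp (-x / A) := by
        gcongr
        linarith
  · intro x hx hx1
    have hpos : 0 < |x| ^ min r (-1 / 2) := Real.rpow_pos_of_pos hx _
    rcases le_or_gt x 0 with hx0 | hx0
    · rw [h0 x hx0, abs_zero]
      positivity
    rw [abs_of_pos hx0] at hx1 hpos ⊢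
    calc |F x| ≤ C * (x ^ r * Real.exp (-(b * x))) := h x hx0
      _ ≤ C * (x ^ min r (-1 / 2) * 1) := by
        have h1 : x ^ r ≤ x ^ min r (-1 / 2) :=
          Real.rpow_le_rpow_of_exponent_ge hx0 hx1.le (min_le_left _ _)
        have h2 : Real.exp (-(b * x)) ≤ 1 := Real.exp_le_one_iff.2 (by nlinarith)
        gcongr
      _ = C * x ^ min r (-1 / 2) := by rw [mul_one]
      _ < A * x ^ min r (-1 / 2) := by
        gcongr
        linarith

theorem integrableOn_rpow_mul_one_sub_rpow {r s : ℝ} (hr : -1 < r) (hs : -1 < s) :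
    IntegrableOn (fun u : ℝ => u ^ r * (1 - u) ^ s) (Ioo 0 1) := by
  have h := Complex.betaIntegral_convergent (u := ((r + 1 : ℝ) : ℂ)) (v := ((s + 1 : ℝ) : ℂ))
    (by rw [Complex.ofReal_re]; linarith) (by rw [Complex.ofReal_re]; linarith)
  rw [intervalIntegrable_iff_integrableOn_Ioo_of_le zero_le_one] at h
  refine IntegrableOn.congr_fun h.norm (fun u hu => ?_) measurableSet_Ioo
  have h1 : 0 < 1 - u := sub_pos.2 hu.2
  have h2 : (1 : ℂ) - u = ((1 - u : ℝ) : ℂ) := by push_cast; ring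
  simp only [norm_mul]
  rw [h2, Complex.norm_cpow_eq_rpow_re_of_pos hu.1, Complex.norm_cpow_eq_rpow_re_of_pos h1]
  simp

/-- The convolution of functions supported on `(0, ∞)` vanishes on `(-∞, 0]`. -/
theorem conv_eq_zero_of_nonpos {F G : ℝ → ℝ} (hF : ∀ x ≤ (0 : ℝ), F x = 0)
    (hG : ∀ x ≤ (0 : ℝ), G x = 0) {x : ℝ} (hx : x ≤ 0) : conv F G x = 0 := by
  have h : (fun y => F y * G (x - y)) = fun _ => 0 := by
    funext y
    rcases le_or_gt y 0 with hy | hy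
    · rw [hF y hy, zero_mul]
    · rw [hG _ (by linarith), mul_zero]
  simp [conv, h]

/-- The convolution of two functions dominated by Gamma densities is bounded by a Gamma density
at every point of `(0, ∞)`. -/
theorem GammaDominated.conv_bound {F G : ℝ → ℝ} (hF : GammaDominated F)
    (hG : GammaDominated G) :
    ∃ C b r : ℝ, 0 ≤ C ∧ 0 < b ∧ -1 < r ∧ ∀ x, 0 < x → GammaBoundAt C b r (conv F G) x := by
  obtain ⟨hF0, C, b, r, hC, hb, hr, hFb⟩ := hF
  obtain ⟨hG0, D, c, s, hD, hc, hs, hGb⟩ := hG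
  set g : ℝ → ℝ := (Ioo 0 1).indicator fun u => u ^ r * (1 - u) ^ s with hg
  have hgi : Integrable g :=
    (integrable_indicator_iff measurableSet_Ioo).2 (integrableOn_rpow_mul_one_sub_rpow hr hs)
  have hg0 : ∀ u, 0 ≤ g u := indicator_nonneg fun u hu =>
    mul_nonneg (Real.rpow_nonneg hu.1.le _) (Real.rpow_nonneg (sub_pos.2 hu.2).le _)
  refine ⟨C * D * ∫ u, g u, min b c, r + s + 1,
    mul_nonneg (mul_nonneg hC hD) (integral_nonneg hg0), lt_min hb hc, by linarith,
    fun x hx => ?_⟩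
  set d := min b c with hd
  set M := C * D * x ^ (r + s) * Real.exp (-(d * x)) with hM
  have hM0 : 0 ≤ M := by positivity
  have hGb' : ∀ᵐ y, 0 < x - y → GammaBoundAt D c s G (x - y) :=
    (Measure.measurePreserving_sub_left volume x).quasiMeasurePreserving.ae hGb
  have hle : ∀ᵐ y, ‖F y * G (x - y)‖ ≤ M * g (y / x) := by
    filter_upwards [hFb, hGb'] with y hy hy'
    have hnn : 0 ≤ M * g (y / x) := mul_nonneg hM0 (hg0 _)
    rcases le_or_gt y 0 with hy0 | hy0
    · simpa [hF0 y hy0] using hnn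
    rcases le_or_gt (x - y) 0 with hxy | hxy
    · simpa [hG0 _ hxy] using hnn
    have hmem : y / x ∈ Ioo (0 : ℝ) 1 := ⟨by positivity, (div_lt_one hx).2 (by linarith)⟩
    have h1 := (hy hy0).mono_rate hC hy0 (min_le_left b c)
    have h2 := (hy' hxy).mono_rate hD hxy (min_le_right b c)
    have e1 : y ^ r = x ^ r * (y / x) ^ r := by
      rw [← Real.mul_rpow hx.le hmem.1.le, mul_div_cancel₀ _ hx.ne']
    have e2 : (x - y) ^ s = x ^ s * (1 - y / x) ^ s := by
      rw [← Real.mul_rpow hx.le (sub_pos.2 hmem.2).le]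
      congr 1
      field_simp
    have e3 : Real.exp (-(d * x)) = Real.exp (-(d * y)) * Real.exp (-(d * (x - y))) := by
      rw [← Real.exp_add]
      congr 1
      ring
    rw [norm_mul, Real.norm_eq_abs, Real.norm_eq_abs]
    calc |F y| * |G (x - y)|
        ≤ C * (y ^ r * Real.exp (-(d * y))) * (D * ((x - y) ^ s * Real.exp (-(d * (x - y))))) :=
          mul_le_mul h1 h2 (abs_nonneg _) ((abs_nonneg _).trans h1)
      _ = M * g (y / x) := by
        rw [hg, indicator_of_mem hmem, hM, e1, e2, e3, Real.rpow_add hx]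
        ring
  have hbound : |conv F G x| ≤ ∫ y, M * g (y / x) :=
    norm_integral_le_of_norm_le ((hgi.comp_div hx.ne').const_mul M) hle
  refine hbound.trans_eq ?_
  rw [integral_const_mul, Measure.integral_comp_div, abs_of_pos hx, smul_eq_mul, hM,
    Real.rpow_add hx (r + s) 1, Real.rpow_one]
  ring

theorem GammaDominated.conv {F G : ℝ → ℝ} (hF : GammaDominated F) (hG : GammaDominated G) :
    GammaDominated (conv F G) := by
  obtain ⟨C, b, r, hC, hb, hr, h⟩ := hF.conv_bound hG
  exact ⟨fun x hx => conv_eq_zero_of_nonpos hF.1 hG.1 hx, C, b, r, hC, hb, hr, .of_forall h⟩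

theorem GammaDominated.propW_conv {F G : ℝ → ℝ} (hF : GammaDominated F)
    (hG : GammaDominated G) : PropW (_root_.conv F G) := by
  obtain ⟨C, b, r, hC, hb, hr, h⟩ := hF.conv_bound hG
  exact .of_gammaBoundAt (fun x hx => conv_eq_zero_of_nonpos hF.1 hG.1 hx) hC hb hr h

theorem GammaDominated.multiConv {f : ℝ → ℝ} {l : List (ℝ → ℝ)} (hf : GammaDominated f)
    (hl : ∀ g ∈ l, GammaDominated g) : GammaDominated (multiConv (f :: l)) := by
  induction l generalizing f with
  | nil => exact hf
  | cons g l ih =>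
    rw [List.forall_mem_cons] at hl
    exact hf.conv (ih hl.1 hl.2)

/-- property `𝒲` is preserved under convolutions of integrable
functions supported on `(0,∞)`. -/
theorem stmt10 (m : ℕ) (hm : 1 ≤ m) (F : Fin m → ℝ → ℝ)
    (hsupp : ∀ i, ∀ x ≤ (0:ℝ), F i x = 0)
    (hint : ∀ i, IntegrableOn (F i) (Ioi 0))
    (hW : ∀ i, PropW (F i)) :
    PropW (multiConv (List.ofFn F)) := by
  have hdom : ∀ i, GammaDominated (F i) := fun i => (hW i).gammaDominated (hsupp i)
  match m, hm with
  | 1, _ => simpa [multiConv] using hW 0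
  | k + 2, _ =>
    rw [List.ofFn_succ, List.ofFn_succ]
    refine (hdom _).propW_conv ((hdom _).multiConv fun g hg => ?_)
    obtain ⟨i, rfl⟩ := (List.mem_ofFn' _ _).1 hg
    exact hdom _
end

section
/- Let G₁ be an integrable function on (0,∞) and G₂ an integrable function on (−∞,0), both smooth on their domains, with G₂ analytic at zero. Assume that for every k∈ℕ the function x ↦ x^k·G₁^{(k)}(x) has property 𝒲 and the function x ↦ G₂^{(k)}(x) has property 𝒲. Then for every k∈ℕ the function x ↦ x^k·(G₁*G₂)^{(k)}(x) has property 𝒲. -/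
open MeasureTheory Set

/-- A function defined on a left neighbourhood of `0` is analytic at zero if it
extends to a function analytic on an interval around `0`. -/
def AnalyticAtZeroLeft (F : ℝ → ℝ) : Prop :=
  ∃ ε > (0:ℝ), ∃ g : ℝ → ℝ, (∀ x ∈ Set.Ioo (-ε) ε, AnalyticAt ℝ g x) ∧
    ∀ x ∈ Set.Ioo (-ε) (0:ℝ), g x = F x

/-- A bound `C * exp (-c * |x|)` away from `0` implies property `𝒲`. -/
lemma PropW.of_exp_bound {F : ℝ → ℝ} {C c : ℝ} (hc : 0 < c)
    (h : ∀ x ≠ 0, |F x| ≤ C * Real.exp (-c * |x|)) : PropW F := by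
  have hc' : 0 < 1 / c := by positivity
  refine ⟨|C| + 1 / c + 2, by linarith [abs_nonneg C], 0, le_rfl, -1 / 2, by norm_num, ?_, ?_⟩
  · intro x hx
    have hA : 0 < |C| + 1 / c + 2 := by positivity
    refine (h x (abs_pos.mp hx)).trans_lt ?_
    have hle : -c * |x| ≤ -|x| / (|C| + 1 / c + 2) := by
      have h1 : 1 / (|C| + 1 / c + 2) ≤ c := by
        rw [div_le_comm₀ hA hc]
        linarith [abs_nonneg C]
      calc -c * |x| ≤ -(1 / (|C| + 1 / c + 2)) * |x| := by gcongr
        _ = _ := by ring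
    calc C * Real.exp (-c * |x|) ≤ |C| * Real.exp (-|x| / (|C| + 1 / c + 2)) := by
          gcongr
          exact le_abs_self C
      _ < _ := by
          gcongr
          linarith
  · intro x h1 h2
    linarith

lemma ContDiffOn.continuousOn_iteratedDeriv_of_isOpen {g : ℝ → ℝ} {U : Set ℝ} (hU : IsOpen U)
    (hg : ContDiffOn ℝ (⊤ : ℕ∞) g U) (k : ℕ) : ContinuousOn (iteratedDeriv k g) U :=
  (hg.continuousOn_iteratedDerivWithin (by exact_mod_cast le_top) hU.uniqueDiffOn).congr
    (iteratedDerivWithin_of_isOpen hU).symm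

lemma ContDiffOn.hasDerivAt_iteratedDeriv_of_isOpen {g : ℝ → ℝ} {U : Set ℝ} (hU : IsOpen U)
    (hg : ContDiffOn ℝ (⊤ : ℕ∞) g U) (k : ℕ) {x : ℝ} (hx : x ∈ U) :
    HasDerivAt (iteratedDeriv k g) (iteratedDeriv (k + 1) g x) x := by
  rw [iteratedDeriv_succ]
  have h : DifferentiableOn ℝ (iteratedDeriv k g) U :=
    (hg.differentiableOn_iteratedDerivWithin (m := k)
      (by exact_mod_cast ENat.natCast_lt_top k) hU.uniqueDiffOn).congr
      (iteratedDerivWithin_of_isOpen hU).symm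
  exact (h.differentiableAt (hU.mem_nhds hx)).hasDerivAt

/-- Differentiating a convolution-type integral under the integral sign, on an open set where the
kernel is smooth with locally uniformly bounded derivatives. -/
lemma iteratedDeriv_setIntegral_mul_sub {f g : ℝ → ℝ} {S U : Set ℝ} (hS : MeasurableSet S)
    (hU : IsOpen U) (hUS : ∀ x ∈ U, ∀ u ∈ S, x - u ∈ U) (hf : IntegrableOn f S)
    (hg : ContDiffOn ℝ (⊤ : ℕ∞) g U)
    (hb : ∀ k, ∀ x ∈ U, ∃ δ > 0, ∃ M, ∀ z ∈ Metric.ball x δ, ∀ u ∈ S,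
      |iteratedDeriv k g (z - u)| ≤ M) (k : ℕ) :
    ∀ x ∈ U, iteratedDeriv k (fun x => ∫ u in S, f u * g (x - u)) x =
      ∫ u in S, f u * iteratedDeriv k g (x - u) := by
  have hmeas : ∀ k, ∀ x ∈ U,
      AEStronglyMeasurable (fun u => iteratedDeriv k g (x - u)) (volume.restrict S) := by
    intro k x hx
    refine ContinuousOn.aestronglyMeasurable ?_ hS
    exact (hg.continuousOn_iteratedDeriv_of_isOpen hU k).comp (by fun_prop) (fun u hu => hUS x hx u hu)
  induction k with
  | zero => simp
  | succ k ih =>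
    intro x hx
    have hev : iteratedDeriv k (fun x => ∫ u in S, f u * g (x - u)) =ᶠ[nhds x]
        fun x => ∫ u in S, f u * iteratedDeriv k g (x - u) :=
      Filter.eventually_of_mem (hU.mem_nhds hx) ih
    rw [iteratedDeriv_succ, hev.deriv_eq]
    obtain ⟨δ, hδ, M, hM⟩ := hb (k + 1) x hx
    obtain ⟨δ₀, hδ₀, M₀, hM₀⟩ := hb k x hx
    refine (hasDerivAt_integral_of_dominated_loc_of_deriv_le
      (F' := fun x u => f u * iteratedDeriv (k + 1) g (x - u)) (bound := fun u => |f u| * M)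
      (Filter.inter_mem (hU.mem_nhds hx) (Metric.ball_mem_nhds x hδ)) ?_ ?_ ?_ ?_ ?_ ?_).2.deriv
    · filter_upwards [hU.mem_nhds hx] with z hz
      exact hf.aestronglyMeasurable.mul (hmeas k z hz)
    · refine hf.mul_bdd (c := M₀) (hmeas k x hx) ?_
      filter_upwards [ae_restrict_mem hS] with u hu
      exact hM₀ x (Metric.mem_ball_self hδ₀) u hu
    · exact hf.aestronglyMeasurable.mul (hmeas (k + 1) x hx)
    · filter_upwards [ae_restrict_mem hS] with u hu z hz
      rw [norm_mul, Real.norm_eq_abs, Real.norm_eq_abs]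
      gcongr
      exact hM z hz.2 u hu
    · exact hf.abs.mul_const M
    · filter_upwards [ae_restrict_mem hS] with u hu z hz
      have h1 := hg.hasDerivAt_iteratedDeriv_of_isOpen hU k (hUS z hz.1 u hu)
      simpa using (HasDerivAt.comp_sub_const z u h1).const_mul (f u)

/-- A function with property `𝒲` is integrable on `(0,∞)` against some growing exponential. -/
lemma PropW.exists_integrableOn_mul_exp {F : ℝ → ℝ} (hF : PropW F)
    (hc : ContinuousOn F (Ioi 0)) :
    ∃ c > 0, IntegrableOn (fun v => |F v| * Real.exp (c * v)) (Ioi 0) := by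
  obtain ⟨A, hA, t, ht, r, hr, h1, h2⟩ := hF
  have hA0 : 0 < A := by linarith
  refine ⟨1 / (2 * A), by positivity, ?_⟩
  have hmeas : ∀ s ⊆ Ioi (0 : ℝ), MeasurableSet s → AEStronglyMeasurable
      (fun v => |F v| * Real.exp (1 / (2 * A) * v)) (volume.restrict s) := by
    intro s hs hms
    exact ContinuousOn.aestronglyMeasurable ((hc.mono hs).abs.mul (by fun_prop)) hms
  have hnear : IntegrableOn (fun v => |F v| * Real.exp (1 / (2 * A) * v)) (Ioo 0 t) := by
    rcases ht.eq_or_lt with rfl | ht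
    · simp
    refine Integrable.mono' (g := fun v => A * Real.exp (1 / (2 * A) * t) * v ^ r)
      (((intervalIntegral.integrableOn_Ioo_rpow_iff ht).mpr hr.1).const_mul _)
      (hmeas _ (fun v hv => hv.1) measurableSet_Ioo) ?_
    filter_upwards [ae_restrict_mem measurableSet_Ioo] with v hv
    have hv0 : |v| = v := abs_of_pos hv.1
    have h := h2 v (by rw [hv0]; exact hv.1) (by rw [hv0]; exact hv.2)
    rw [hv0] at h
    rw [Real.norm_of_nonneg (by positivity)]
    calc |F v| * Real.exp (1 / (2 * A) * v) ≤ (A * v ^ r) * Real.exp (1 / (2 * A) * t) := by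
          gcongr
          · exact (abs_nonneg _).trans h.le
          · exact hv.2.le
      _ = _ := by ring
  have hfar : IntegrableOn (fun v => |F v| * Real.exp (1 / (2 * A) * v)) (Ioi t) := by
    refine Integrable.mono' (g := fun v => A * Real.exp (-(1 / (2 * A)) * v))
      ((exp_neg_integrableOn_Ioi t (by positivity)).const_mul _)
      (hmeas _ (Ioi_subset_Ioi ht) measurableSet_Ioi) ?_
    filter_upwards [ae_restrict_mem measurableSet_Ioi] with v hv
    have hv0 : |v| = v := abs_of_pos (ht.trans_lt hv)
    have h := h1 v (by rw [hv0]; exact hv)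
    rw [hv0] at h
    rw [Real.norm_of_nonneg (by positivity)]
    calc |F v| * Real.exp (1 / (2 * A) * v)
        ≤ (A * Real.exp (-v / A)) * Real.exp (1 / (2 * A) * v) := by gcongr
      _ = _ := by
          rw [mul_assoc, ← Real.exp_add]
          congr 2
          field_simp
          ring
  have hpt : IntegrableOn (fun v => |F v| * Real.exp (1 / (2 * A) * v)) {t} := by
    exact integrableOn_singleton (hx := by simp) (hfx := by finiteness)
  refine ((hnear.union hpt).union hfar).mono_set fun v hv => ?_
  rcases lt_trichotomy v t with h | h | h
  · exact Or.inl (Or.inl ⟨hv, h⟩)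
  · exact Or.inl (Or.inr h)
  · exact Or.inr h

/-- The derivatives of a smooth function on `(-∞,0)` that is analytic at zero are bounded on
bounded sets. -/
lemma AnalyticAtZeroLeft.exists_bound_iteratedDeriv {G : ℝ → ℝ} (hG : AnalyticAtZeroLeft G)
    (hsm : ContDiffOn ℝ (⊤ : ℕ∞) G (Iio 0)) (k : ℕ) (T : ℝ) :
    ∃ M, ∀ x < 0, -T ≤ x → |iteratedDeriv k G x| ≤ M := by
  obtain ⟨ε, hε, g, hg, hgG⟩ := hG
  obtain ⟨M₁, hM₁⟩ := isCompact_Icc.exists_bound_of_continuousOn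
    ((hsm.continuousOn_iteratedDeriv_of_isOpen isOpen_Iio k).mono
      (fun x (hx : x ∈ Icc (-T) (-(ε / 2))) => show x < 0 by linarith [hx.2]))
  have hgc : ContinuousOn (iteratedDeriv k g) (Icc (-(ε / 2)) 0) := by
    intro x hx
    rw [iteratedDeriv_eq_iterate]
    exact ((hg x ⟨by linarith [hx.1], by linarith [hx.2]⟩).iterated_deriv
      k).continuousAt.continuousWithinAt
  obtain ⟨M₂, hM₂⟩ := isCompact_Icc.exists_bound_of_continuousOn hgc
  refine ⟨max M₁ M₂, fun x hx hT => ?_⟩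
  rcases le_total x (-(ε / 2)) with h | h
  · exact (hM₁ x ⟨hT, h⟩).trans (le_max_left _ _)
  · have hev : g =ᶠ[nhds x] G :=
      Filter.eventually_of_mem (Ioo_mem_nhds (by linarith : -ε < x) hx) hgG
    rw [← hev.iteratedDeriv_eq k]
    exact (hM₂ x ⟨h, hx.le⟩).trans (le_max_right _ _)

/-- The derivatives in question decay exponentially on all of `(-∞,0)`. -/
lemma AnalyticAtZeroLeft.exists_exp_bound {G : ℝ → ℝ} (hG : AnalyticAtZeroLeft G)
    (hsm : ContDiffOn ℝ (⊤ : ℕ∞) G (Iio 0)) {k : ℕ} (hW : PropW (iteratedDeriv k G)) :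
    ∃ c > 0, ∃ C ≥ 0, ∀ x < 0, |iteratedDeriv k G x| ≤ C * Real.exp (c * x) := by
  obtain ⟨A, hA, t, ht, r, hr, h1, -⟩ := hW
  obtain ⟨M, hM⟩ := hG.exists_bound_iteratedDeriv hsm k t
  have hA0 : 0 < A := by linarith
  refine ⟨1 / A, by positivity, max A (|M| * Real.exp (1 / A * t)),
    hA0.le.trans (le_max_left _ _), fun x hx => ?_⟩
  rcases le_or_gt (-t) x with h | h
  · calc |iteratedDeriv k G x| ≤ |M| * 1 := by
          rw [mul_one]
          exact (hM x hx h).trans (le_abs_self M)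
      _ ≤ |M| * Real.exp (1 / A * t + 1 / A * x) := by
          gcongr
          rw [← mul_add]
          exact Real.one_le_exp (mul_nonneg (by positivity) (by linarith))
      _ = (|M| * Real.exp (1 / A * t)) * Real.exp (1 / A * x) := by rw [Real.exp_add, mul_assoc]
      _ ≤ _ := by
          gcongr
          exact le_max_right _ _
  · have hx0 : |x| = -x := abs_of_neg hx
    have h := h1 x (by rw [hx0]; linarith)
    rw [hx0, neg_neg] at h
    calc |iteratedDeriv k G x| ≤ A * Real.exp (1 / A * x) := by
          rw [one_div_mul_eq_div]
          exact h.le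
      _ ≤ _ := by
          gcongr
          exact le_max_left _ _

/-- If `x ^ k * G⁽ᵏ⁾ x` has property `𝒲`, then `G⁽ᵏ⁾` is bounded on `[δ,∞)`. -/
lemma PropW.exists_bound_iteratedDeriv {G : ℝ → ℝ} {k : ℕ}
    (hW : PropW (fun x => x ^ k * iteratedDeriv k G x))
    (hsm : ContDiffOn ℝ (⊤ : ℕ∞) G (Ioi 0)) {δ : ℝ} (hδ : 0 < δ) :
    ∃ M, ∀ x ≥ δ, |iteratedDeriv k G x| ≤ M := by
  obtain ⟨A, hA, t, ht, r, hr, h1, -⟩ := hW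
  have hA0 : 0 < A := by linarith
  obtain ⟨M, hM⟩ := isCompact_Icc.exists_bound_of_continuousOn
    ((hsm.continuousOn_iteratedDeriv_of_isOpen isOpen_Ioi k).mono
      (fun x (hx : x ∈ Icc δ t) => hδ.trans_le hx.1))
  refine ⟨max M (A / δ ^ k), fun x hx => ?_⟩
  rcases le_or_gt x t with h | h
  · exact (hM x ⟨hx, h⟩).trans (le_max_left _ _)
  · refine le_trans ?_ (le_max_right _ _)
    have hx0 : 0 < x := hδ.trans_le hx
    have h2 := h1 x (by rwa [abs_of_pos hx0])
    rw [abs_mul, abs_of_pos (pow_pos hx0 k)] at h2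
    rw [le_div_iff₀ (by positivity)]
    calc |iteratedDeriv k G x| * δ ^ k ≤ |iteratedDeriv k G x| * x ^ k := by gcongr
      _ = x ^ k * |iteratedDeriv k G x| := mul_comm _ _
      _ ≤ A * Real.exp (-|x| / A) := h2.le
      _ ≤ A * 1 := by
          gcongr
          exact Real.exp_le_one_iff.mpr (div_nonpos_of_nonpos_of_nonneg (by simp) hA0.le)
      _ = A := mul_one A

lemma conv_eq_setIntegral_Ioi {F G : ℝ → ℝ} (hF : ∀ x ≤ (0 : ℝ), F x = 0) :
    conv F G = fun x => ∫ y in Ioi 0, F y * G (x - y) := by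
  funext x
  refine (setIntegral_eq_integral_of_forall_compl_eq_zero fun y hy => ?_).symm
  rw [hF y (not_lt.mp hy), zero_mul]

lemma conv_eq_setIntegral_Iio {F G : ℝ → ℝ} (hG : ∀ x ≥ (0 : ℝ), G x = 0) :
    conv F G = fun x => ∫ u in Iio 0, G u * F (x - u) := by
  funext x
  rw [setIntegral_eq_integral_of_forall_compl_eq_zero fun u hu => ?_]
  · rw [conv, ← integral_sub_left_eq_self _ volume x]
    simp [mul_comm]
  · rw [hG u (not_lt.mp hu), zero_mul]

/-- if `G₁` (supported on `(0,∞)`) and `G₂` (supported on `(−∞,0)`,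
analytic at zero) are smooth with `x^k·G₁^{(k)}` and `G₂^{(k)}` having property `𝒲`
for every `k`, then `x^k·(G₁*G₂)^{(k)}` has property `𝒲` for every `k`. -/
theorem stmt12 (G₁ G₂ : ℝ → ℝ)
    (hsupp₁ : ∀ x ≤ (0:ℝ), G₁ x = 0) (hsupp₂ : ∀ x ≥ (0:ℝ), G₂ x = 0)
    (hint₁ : IntegrableOn G₁ (Ioi 0)) (hint₂ : IntegrableOn G₂ (Iio 0))
    (hsm₁ : ContDiffOn ℝ (⊤ : ℕ∞) G₁ (Ioi 0)) (hsm₂ : ContDiffOn ℝ (⊤ : ℕ∞) G₂ (Iio 0))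
    (hanal₂ : AnalyticAtZeroLeft G₂)
    (hW₁ : ∀ k : ℕ, PropW (fun x => x ^ k * iteratedDeriv k G₁ x))
    (hW₂ : ∀ k : ℕ, PropW (fun x => iteratedDeriv k G₂ x)) :
    ∀ k : ℕ, PropW (fun x => x ^ k * iteratedDeriv k (conv G₁ G₂) x) := by
  intro k
  have hneg : ∃ c > 0, ∃ C, ∀ x < 0,
      |iteratedDeriv k (conv G₁ G₂) x| ≤ C * Real.exp (c * x) := by
    obtain ⟨c, hc, C, hC, hb⟩ := hanal₂.exists_exp_bound hsm₂ (hW₂ k)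
    refine ⟨c, hc, ∫ y in Ioi (0 : ℝ), |G₁ y| * C, fun x hx => ?_⟩
    rw [conv_eq_setIntegral_Ioi hsupp₁, iteratedDeriv_setIntegral_mul_sub measurableSet_Ioi
      isOpen_Iio (fun x (hx : x < 0) u (hu : 0 < u) => show x - u < 0 by linarith) hint₁ hsm₂
      ?_ k x hx, ← integral_mul_const, ← Real.norm_eq_abs]
    · refine norm_integral_le_of_norm_le ((hint₁.abs.mul_const C).mul_const _) ?_
      filter_upwards [ae_restrict_mem measurableSet_Ioi] with y hy
      have hy : 0 < y := hy
      rw [norm_mul, Real.norm_eq_abs, Real.norm_eq_abs, mul_assoc]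
      gcongr
      refine (hb (x - y) (by linarith)).trans ?_
      gcongr
      linarith
    · intro j z (hz : z < 0)
      obtain ⟨c, hc, C, hC, hb⟩ := hanal₂.exists_exp_bound hsm₂ (hW₂ j)
      refine ⟨-z, by linarith, C, fun w hw u (hu : 0 < u) => ?_⟩
      rw [Metric.mem_ball, Real.dist_eq, abs_lt] at hw
      have hwu : w - u < 0 := by linarith
      refine (hb _ hwu).trans (mul_le_of_le_one_right hC ?_)
      exact Real.exp_le_one_iff.mpr (by nlinarith)
  have hpos : ∃ c > 0, ∃ C, ∀ x > 0,
      |x ^ k * iteratedDeriv k (conv G₁ G₂) x| ≤ C * Real.exp (-c * x) := by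
    obtain ⟨c₂, hc₂, C₂, hC₂, hb₂⟩ := hanal₂.exists_exp_bound hsm₂ (hW₂ 0)
    have hcont : ContinuousOn (fun x => x ^ k * iteratedDeriv k G₁ x) (Ioi 0) :=
      ContinuousOn.mul (by fun_prop) (hsm₁.continuousOn_iteratedDeriv_of_isOpen isOpen_Ioi k)
    obtain ⟨c, hc, hi⟩ := (hW₁ k).exists_integrableOn_mul_exp hcont
    set Φ : ℝ → ℝ := (Ioi 0).indicator
      (fun v => |v ^ k * iteratedDeriv k G₁ v| * Real.exp (c * v)) with hΦ
    have hΦi : Integrable Φ := hi.integrable_indicator measurableSet_Ioi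
    have hΦ0 : ∀ v, 0 ≤ Φ v := indicator_nonneg fun v _ => by positivity
    refine ⟨c, hc, C₂ * ∫ v, Φ v, fun x hx => ?_⟩
    rw [conv_eq_setIntegral_Iio hsupp₂, iteratedDeriv_setIntegral_mul_sub measurableSet_Iio
      isOpen_Ioi (fun x (hx : 0 < x) u (hu : u < 0) => show 0 < x - u by linarith) hint₂ hsm₁
      ?_ k x hx, ← integral_const_mul]
    · have hΦx : Integrable (fun u => C₂ * Φ (x - u) * Real.exp (-c * x)) :=
        ((hΦi.comp_sub_left x).const_mul C₂).mul_const _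
      have hle : ‖∫ u in Iio 0, x ^ k * (G₂ u * iteratedDeriv k G₁ (x - u))‖ ≤
          ∫ u in Iio 0, C₂ * Φ (x - u) * Real.exp (-c * x) := by
        refine norm_integral_le_of_norm_le hΦx.integrableOn ?_
        filter_upwards [ae_restrict_mem measurableSet_Iio] with u hu
        have hu : u < 0 := hu
        have hxu : x - u ∈ Ioi 0 := show 0 < x - u by linarith
        have hG₂ : |G₂ u| ≤ C₂ := by
          have h := hb₂ u hu
          rw [iteratedDeriv_zero] at h
          exact h.trans (mul_le_of_le_one_right hC₂ (Real.exp_le_one_iff.mpr (by nlinarith)))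
        rw [hΦ, indicator_of_mem hxu, Real.norm_eq_abs, abs_mul, abs_mul, abs_mul,
          abs_of_pos (pow_pos (show 0 < x from hx) k), abs_of_pos (pow_pos (show 0 < x - u from hxu) k)]
        have hxu' : 0 < x - u := hxu
        calc x ^ k * (|G₂ u| * |iteratedDeriv k G₁ (x - u)|)
            ≤ (x - u) ^ k * (C₂ * |iteratedDeriv k G₁ (x - u)|) * 1 := by
              rw [mul_one]
              gcongr
              linarith
          _ ≤ (x - u) ^ k * (C₂ * |iteratedDeriv k G₁ (x - u)|) *
              Real.exp (c * (x - u) + -c * x) := by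
              gcongr
              exact Real.one_le_exp (by nlinarith)
          _ = _ := by
              rw [Real.exp_add]
              ring
      refine hle.trans ((setIntegral_le_integral hΦx (Filter.Eventually.of_forall fun u =>
        mul_nonneg (mul_nonneg hC₂ (hΦ0 _)) (Real.exp_pos _).le)).trans_eq ?_)
      rw [integral_mul_const, integral_const_mul, integral_sub_left_eq_self Φ volume x]
    · intro j z (hz : 0 < z)
      obtain ⟨M, hM⟩ := (hW₁ j).exists_bound_iteratedDeriv hsm₁ (half_pos hz)
      refine ⟨z / 2, half_pos hz, M, fun w hw u (hu : u < 0) => hM _ ?_⟩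
      rw [Metric.mem_ball, Real.dist_eq, abs_lt] at hw
      linarith
  obtain ⟨c₁, hc₁, C₁, h₁⟩ := hneg
  obtain ⟨c₂, hc₂, C₂, h₂⟩ := hpos
  set D : ℝ := k.factorial / (c₁ / 2) ^ k with hD
  have hD0 : 0 ≤ D := by positivity
  refine PropW.of_exp_bound (C := max (D * |C₁|) |C₂|) (c := min (c₁ / 2) c₂)
    (lt_min (by positivity) hc₂) fun x hx => ?_
  rcases hx.lt_or_gt with hx | hx
  · have hpow : |x| ^ k ≤ D * Real.exp (c₁ / 2 * |x|) := by
      have h := Real.pow_div_factorial_le_exp (c₁ / 2 * |x|) (by positivity) k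
      rw [div_le_iff₀ (by positivity), mul_pow] at h
      rw [hD, div_mul_eq_mul_div, le_div_iff₀ (by positivity)]
      linarith
    calc |x ^ k * iteratedDeriv k (conv G₁ G₂) x|
        = |x| ^ k * |iteratedDeriv k (conv G₁ G₂) x| := by rw [abs_mul, abs_pow]
      _ ≤ (D * Real.exp (c₁ / 2 * |x|)) * (|C₁| * Real.exp (c₁ * x)) := by
          gcongr
          refine (h₁ x hx).trans ?_
          gcongr
          exact le_abs_self C₁
      _ = D * |C₁| * Real.exp (c₁ / 2 * |x| + c₁ * x) := by
          rw [Real.exp_add]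
          ring
      _ = D * |C₁| * Real.exp (-(c₁ / 2) * |x|) := by
          rw [abs_of_neg hx]
          congr 2
          ring
      _ ≤ _ := by
          gcongr
          · exact le_max_left _ _
          · exact min_le_left _ _
  · rw [abs_of_pos hx]
    calc |x ^ k * iteratedDeriv k (conv G₁ G₂) x| ≤ C₂ * Real.exp (-c₂ * x) := h₂ x hx
      _ ≤ _ := by
          gcongr
          · exact (le_abs_self C₂).trans (le_max_right _ _)
          · exact min_le_right _ _
end

section
/- For q∈ℕ, q≥1, define f̃_q:(0,1)→ℝ by f̃_q(x) = ∑_{k=0}^{q−1} f((x+k)/q), where f(y) = −ln(y) − ln(1−y) − 2 for y∈(0,1). Then the sequence (f̃_q) converges uniformly on (0,1), as q→∞, to the function x ↦ ln(1/(2·sin(πx))). -/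
open MeasureTheory Set Filter

theorem log_Gamma_add_one {y : ℝ} (hy : 0 < y) :
    Real.log (Real.Gamma (y + 1)) = Real.log (Real.Gamma y) + Real.log y := by
  rw [Real.Gamma_add_one hy.ne', Real.log_mul hy.ne' (Real.Gamma_pos_of_pos hy).ne', add_comm]

theorem log_Gamma_add_nat {x : ℝ} (hx : 0 < x) (n : ℕ) :
    Real.log (Real.Gamma (x + n)) =
      Real.log (Real.Gamma x) + ∑ k ∈ Finset.range n, Real.log (x + k) :=
  Real.BohrMollerup.f_add_nat_eq (f := Real.log ∘ Real.Gamma) log_Gamma_add_one hx n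

theorem log_Gamma_natCast_add_le {n : ℕ} (hn : n ≠ 0) {x : ℝ} (hx : 0 < x) (hx' : x ≤ 1) :
    Real.log (Real.Gamma (n + x)) ≤ Real.log (Real.Gamma n) + x * Real.log n :=
  Real.BohrMollerup.f_add_nat_le (f := Real.log ∘ Real.Gamma) Real.convexOn_log_Gamma
    log_Gamma_add_one hn hx hx'

theorem le_log_Gamma_natCast_add {n : ℕ} (hn : 2 ≤ n) {x : ℝ} (hx : 0 < x) :
    Real.log (Real.Gamma n) + x * Real.log (n - 1) ≤ Real.log (Real.Gamma (n + x)) :=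
  Real.BohrMollerup.f_add_nat_ge (f := Real.log ∘ Real.Gamma) Real.convexOn_log_Gamma
    log_Gamma_add_one hn hx

/-- The reflection formula gives a closed form for the sum in terms of `Real.Gamma`. -/
theorem sum_neg_log_sub_log_eq {q : ℕ} (hq : q ≠ 0) {x : ℝ} (hx : x ∈ Ioo (0 : ℝ) 1) :
    ∑ k ∈ Finset.range q, (-Real.log ((x + k) / q) - Real.log (1 - (x + k) / q) - 2) =
      Real.log Real.pi - Real.log (Real.sin (Real.pi * x)) - Real.log (Real.Gamma (q + x))
        - Real.log (Real.Gamma (q + (1 - x))) + 2 * q * Real.log q - 2 * q := by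
  obtain ⟨hx0, hx1⟩ := hx
  have hq' : (0 : ℝ) < q := by positivity
  have hsin : 0 < Real.sin (Real.pi * x) :=
    Real.sin_pos_of_pos_of_lt_pi (by positivity) (by nlinarith [Real.pi_pos])
  have hleft : ∑ k ∈ Finset.range q, Real.log ((x + k) / q) =
      ∑ k ∈ Finset.range q, Real.log (x + k) - q * Real.log q := by
    have hterm : ∀ k ∈ Finset.range q, Real.log ((x + k) / q) = Real.log (x + k) - Real.log q :=
      fun k _ => Real.log_div (by positivity) hq'.ne'
    rw [Finset.sum_congr rfl hterm]
    simp
  have hright : ∑ k ∈ Finset.range q, Real.log (1 - (x + k) / q) =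
      ∑ k ∈ Finset.range q, Real.log (1 - x + k) - q * Real.log q := by
    rw [← Finset.sum_range_reflect]
    have hterm : ∀ k ∈ Finset.range q, Real.log (1 - (x + ((q - 1 - k : ℕ) : ℝ)) / q) =
        Real.log (1 - x + k) - Real.log q := by
      intro k hk
      have hkq : k + 1 ≤ q := Finset.mem_range.mp hk
      have hpos : (0 : ℝ) < 1 - x + k := by linarith [Nat.cast_nonneg (α := ℝ) k]
      rw [← Real.log_div hpos.ne' hq'.ne', Nat.sub_sub, add_comm 1 k, Nat.cast_sub hkq]
      congr 1
      field_simp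
      push_cast
      ring
    rw [Finset.sum_congr rfl hterm]
    simp
  have hrefl : Real.log (Real.Gamma x) + Real.log (Real.Gamma (1 - x)) =
      Real.log Real.pi - Real.log (Real.sin (Real.pi * x)) := by
    rw [← Real.log_mul (Real.Gamma_pos_of_pos hx0).ne' (Real.Gamma_pos_of_pos (by linarith)).ne',
      Real.Gamma_mul_Gamma_one_sub, Real.log_div Real.pi_ne_zero hsin.ne']
  have h1 := log_Gamma_add_nat hx0 q
  have h2 := log_Gamma_add_nat (sub_pos.mpr hx1) q
  simp only [Finset.sum_sub_distrib, Finset.sum_neg_distrib, hleft, hright, Finset.sum_const,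
    Finset.card_range, nsmul_eq_mul]
  rw [add_comm (q : ℝ) x, add_comm (q : ℝ) (1 - x)]
  linarith

theorem two_mul_log_Gamma_natCast_add_log {q : ℕ} (hq : q ≠ 0) :
    2 * Real.log (Real.Gamma q) + Real.log q =
      2 * Real.log (Stirling.stirlingSeq q) + Real.log 2 + 2 * q * Real.log q - 2 * q := by
  have hq' : (0 : ℝ) < q := by positivity
  have hfac : Real.log (q.factorial : ℝ) = Real.log (Real.Gamma q) + Real.log q := by
    rw [← Real.Gamma_nat_eq_factorial, log_Gamma_add_one hq']
  have hst := Stirling.log_stirlingSeq_formula q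
  rw [Real.log_mul two_ne_zero hq'.ne', Real.log_div hq'.ne' (Real.exp_pos 1).ne',
    Real.log_exp] at hst
  linarith

theorem tendsto_two_mul_log_stirlingSeq_sub_log_pi :
    Tendsto (fun q : ℕ => 2 * Real.log (Stirling.stirlingSeq q) - Real.log Real.pi)
      atTop (nhds 0) := by
  have h := ((Stirling.tendsto_stirlingSeq_sqrt_pi.log
    (Real.sqrt_pos.mpr Real.pi_pos).ne').const_mul 2).sub_const (Real.log Real.pi)
  convert h using 2
  rw [Real.log_sqrt Real.pi_pos.le]
  ring

theorem tendsto_log_natCast_sub_log_sub_one :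
    Tendsto (fun q : ℕ => Real.log q - Real.log ((q : ℝ) - 1)) atTop (nhds 0) := by
  rw [← tendsto_add_atTop_iff_nat 1]
  simpa using Real.tendsto_log_nat_add_one_sub_log

/-- the functions `f̃_q(x) = ∑_{k=0}^{q−1} f((x+k)/q)`, where
`f(y) = −ln y − ln(1−y) − 2`, converge uniformly on `(0,1)` to
`x ↦ ln(1/(2 sin(πx)))` as `q → ∞`. -/
theorem stmt13 :
    TendstoUniformlyOn
      (fun (q : ℕ) (x : ℝ) => ∑ k ∈ Finset.range q,
        (-Real.log ((x + k) / q) - Real.log (1 - (x + k) / q) - 2))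
      (fun x : ℝ => Real.log (1 / (2 * Real.sin (Real.pi * x))))
      atTop (Ioo (0:ℝ) 1) := by
  rw [Metric.tendstoUniformlyOn_iff]
  intro ε hε
  have hlower := tendsto_two_mul_log_stirlingSeq_sub_log_pi.sub tendsto_log_natCast_sub_log_sub_one
  rw [sub_zero] at hlower
  filter_upwards [tendsto_two_mul_log_stirlingSeq_sub_log_pi.eventually_lt_const hε,
    hlower.eventually_const_lt (neg_lt_zero.mpr hε), eventually_ge_atTop 2] with q hu hl hq x hx
  have hq0 : q ≠ 0 := by omega
  have hsin : 0 < Real.sin (Real.pi * x) :=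
    Real.sin_pos_of_pos_of_lt_pi (mul_pos Real.pi_pos hx.1) (by nlinarith [Real.pi_pos, hx.2])
  have hx' : 0 < 1 - x := sub_pos.mpr hx.2
  have hstirling := two_mul_log_Gamma_natCast_add_log hq0
  have hu1 := log_Gamma_natCast_add_le hq0 hx.1 hx.2.le
  have hu2 := log_Gamma_natCast_add_le hq0 hx' (by linarith [hx.1])
  have hl1 := le_log_Gamma_natCast_add hq hx.1
  have hl2 := le_log_Gamma_natCast_add hq hx'
  rw [sum_neg_log_sub_log_eq hq0 hx, one_div, Real.log_inv, Real.log_mul two_ne_zero hsin.ne',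
    Real.dist_eq, abs_lt]
  constructor <;> linarith
end

section
/- For every natural number q≥1 and every x∈[0,1]: Γ(q+1/2)·Γ(q+1/2) ≤ Γ(q+x)·Γ(q+1−x) ≤ Γ(q)·Γ(q+1). More generally, for fixed q≥1 the function y ↦ Γ(q+1/2+y)·Γ(q+1/2−y) is non-decreasing on [0,1/2]. -/
open Set

/-- For a convex function, the sum of its values at two points symmetric about `c` grows with their
distance from `c`. -/
theorem ConvexOn.add_symm_le_add_symm {S : Set ℝ} {f : ℝ → ℝ} (hf : ConvexOn ℝ S f) {c s t : ℝ}
    (hadd : c + t ∈ S) (hsub : c - t ∈ S) (hst : |s| ≤ t) :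
    f (c + s) + f (c - s) ≤ f (c + t) + f (c - t) := by
  obtain ⟨h₁, h₂⟩ := abs_le.mp hst
  rcases ((abs_nonneg s).trans hst).eq_or_lt with rfl | ht
  · obtain rfl : s = 0 := by linarith
    rfl
  have ha : 0 ≤ (t + s) / (2 * t) := div_nonneg (by linarith) (by linarith)
  have hb : 0 ≤ (t - s) / (2 * t) := div_nonneg (by linarith) (by linarith)
  have hab : (t + s) / (2 * t) + (t - s) / (2 * t) = 1 := by field_simp; ring
  have h₃ := hf.2 hadd hsub ha hb hab
  have h₄ := hf.2 hadd hsub hb ha (by rw [add_comm, hab])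
  simp only [smul_eq_mul] at h₃ h₄
  rw [show (t + s) / (2 * t) * (c + t) + (t - s) / (2 * t) * (c - t) = c + s by
    field_simp; ring] at h₃
  rw [show (t - s) / (2 * t) * (c + t) + (t + s) / (2 * t) * (c - t) = c - s by
    field_simp; ring] at h₄
  calc
    f (c + s) + f (c - s) ≤
        ((t + s) / (2 * t) + (t - s) / (2 * t)) * (f (c + t) + f (c - t)) := by linarith
    _ = f (c + t) + f (c - t) := by rw [hab, one_mul]

theorem Real.Gamma_add_mul_Gamma_sub_le {c s t : ℝ} (hst : |s| ≤ t) (htc : t < c) :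
    Real.Gamma (c + s) * Real.Gamma (c - s) ≤ Real.Gamma (c + t) * Real.Gamma (c - t) := by
  obtain ⟨h₁, h₂⟩ := abs_le.mp hst
  have hpos {x : ℝ} (hx : 0 < x) := Real.Gamma_pos_of_pos hx
  have hs₁ := hpos (show 0 < c + s by linarith)
  have hs₂ := hpos (show 0 < c - s by linarith)
  have ht₁ := hpos (show 0 < c + t by linarith)
  have ht₂ := hpos (show 0 < c - t by linarith)
  rw [← Real.log_le_log_iff (mul_pos hs₁ hs₂) (mul_pos ht₁ ht₂),
    Real.log_mul hs₁.ne' hs₂.ne', Real.log_mul ht₁.ne' ht₂.ne']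
  exact Real.convexOn_log_Gamma.add_symm_le_add_symm (mem_Ioi.mpr (by linarith))
    (mem_Ioi.mpr (by linarith)) hst

/-- for `q ≥ 1` and `x ∈ [0,1]`,
`Γ(q+1/2)² ≤ Γ(q+x)·Γ(q+1−x) ≤ Γ(q)·Γ(q+1)`, and more generally
`y ↦ Γ(q+1/2+y)·Γ(q+1/2−y)` is non-decreasing on `[0,1/2]`. -/
theorem stmt14 (q : ℕ) (hq : 1 ≤ q) :
    (∀ x ∈ Icc (0:ℝ) 1,
      Real.Gamma ((q : ℝ) + 1/2) * Real.Gamma ((q : ℝ) + 1/2) ≤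
        Real.Gamma ((q : ℝ) + x) * Real.Gamma ((q : ℝ) + 1 - x) ∧
      Real.Gamma ((q : ℝ) + x) * Real.Gamma ((q : ℝ) + 1 - x) ≤
        Real.Gamma (q : ℝ) * Real.Gamma ((q : ℝ) + 1)) ∧
    MonotoneOn (fun y : ℝ => Real.Gamma ((q : ℝ) + 1/2 + y) * Real.Gamma ((q : ℝ) + 1/2 - y))
      (Icc (0:ℝ) (1/2)) := by
  have hq' : (1 : ℝ) ≤ q := by exact_mod_cast hq
  refine ⟨fun x hx ↦ ?_, fun s hs t ht hst ↦ ?_⟩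
  · have hadd : (q : ℝ) + x = q + 1 / 2 + (x - 1 / 2) := by ring
    have hsub : (q : ℝ) + 1 - x = q + 1 / 2 - (x - 1 / 2) := by ring
    have habs : |x - 1 / 2| ≤ 1 / 2 := abs_le.mpr ⟨by linarith [hx.1], by linarith [hx.2]⟩
    rw [hadd, hsub]
    constructor
    · rcases le_total 0 (x - 1 / 2) with h | h
      · simpa using Real.Gamma_add_mul_Gamma_sub_le (c := (q : ℝ) + 1 / 2) (s := 0)
          (t := x - 1 / 2) (by rwa [abs_zero]) (by linarith [hx.2])
      · have := Real.Gamma_add_mul_Gamma_sub_le (c := (q : ℝ) + 1 / 2) (s := 0)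
          (t := -(x - 1 / 2)) (by rw [abs_zero]; linarith) (by linarith [hx.1])
        rwa [add_zero, sub_zero, sub_neg_eq_add, ← sub_eq_add_neg, mul_comm (Real.Gamma (_ - _))]
          at this
    · have h := Real.Gamma_add_mul_Gamma_sub_le habs (show 1 / 2 < (q : ℝ) + 1 / 2 by linarith)
      rwa [add_sub_cancel_right, add_assoc (q : ℝ) (1 / 2) (1 / 2), add_halves,
        mul_comm (Real.Gamma ((q : ℝ) + 1))] at h
  · exact Real.Gamma_add_mul_Gamma_sub_le (by rwa [abs_of_nonneg hs.1]) (by linarith [ht.2])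
end

section
/- Let ν be the pushforward of Lebesgue measure on (0,1) under the map x ↦ ln(1/(2·sin(πx))), and for t≠0 let ν_t be the pushforward of ν under x ↦ t·x. Define h:ℝ→ℝ by h(x) = (2/π)·(4e^{2x}−1)^{−1/2} for x > −ln 2 and h(x)=0 for x ≤ −ln 2, and set h_t(x) = (1/|t|)·h(x/t). Then for every t≠0 the measure ν_t is absolutely continuous with respect to Lebesgue measure on ℝ, with density h_t. -/
open MeasureTheory Set

/-- The density `h(x) = (2/π)·(4e^{2x}−1)^{−1/2}` for `x > −ln 2`, and `0`
otherwise. -/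
noncomputable def hdens (x : ℝ) : ℝ :=
  if -Real.log 2 < x then (2 / Real.pi) * (4 * Real.exp (2 * x) - 1) ^ (-(1:ℝ) / 2) else 0

/-- Change of variables for an injective map whose Jacobian times the density `g` is constant. -/
theorem const_mul_volume_preimage_inter {f f' : ℝ → ℝ} {s A : Set ℝ} {g : ℝ → ENNReal}
    {c : ENNReal} (hs : MeasurableSet s) (hA : MeasurableSet A) (hf : Measurable f)
    (hf' : ∀ x ∈ s, HasDerivAt f (f' x) x) (hinj : InjOn f s)
    (hc : ∀ x ∈ s, ENNReal.ofReal |f' x| * g (f x) = c)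
    (hg : ∀ y ∉ f '' s, g y = 0) :
    c * volume (f ⁻¹' A ∩ s) = ∫⁻ y in A, g y := by
  have himage : MeasurableSet (f '' s) := hs.image_of_continuousOn_injOn
    (fun x hx => (hf' x hx).continuousAt.continuousWithinAt) hinj
  have key := lintegral_image_eq_lintegral_abs_deriv_mul hs
    (fun x hx => (hf' x hx).hasDerivWithinAt) hinj (A.indicator g)
  calc c * volume (f ⁻¹' A ∩ s)
      = ∫⁻ x in s, (f ⁻¹' A).indicator (fun _ => c) x := by
        rw [lintegral_indicator_const (hf hA), Measure.restrict_apply (hf hA)]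
    _ = ∫⁻ x in s, ENNReal.ofReal |f' x| * A.indicator g (f x) := by
        refine setLIntegral_congr_fun hs fun x hx => ?_
        by_cases h : f x ∈ A
        · simp [h, hc x hx]
        · simp [h]
    _ = ∫⁻ y in f '' s, A.indicator g y := key.symm
    _ = ∫⁻ y, A.indicator g y := by
        rw [← lintegral_indicator himage]
        congr 1
        ext y
        by_cases h : y ∈ f '' s
        · simp only [indicator_of_mem h]
        · rw [indicator_of_notMem h]
          by_cases hy : y ∈ A <;> simp [hy, hg y h]
    _ = ∫⁻ y in A, g y := lintegral_indicator hA g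

theorem sin_pi_mul_pos {x : ℝ} (hx : x ∈ Ioo (0:ℝ) (1 / 2)) : 0 < Real.sin (Real.pi * x) := by
  have hpi := Real.pi_pos
  exact Real.sin_pos_of_pos_of_lt_pi (mul_pos hpi hx.1) (by nlinarith [hx.2])

theorem cos_pi_mul_pos {x : ℝ} (hx : x ∈ Ioo (0:ℝ) (1 / 2)) : 0 < Real.cos (Real.pi * x) := by
  have hpi := Real.pi_pos
  exact Real.cos_pos_of_mem_Ioo ⟨by nlinarith [hx.1], by nlinarith [hx.2]⟩

theorem hasDerivAt_log_inv_sin {x : ℝ} (hx : x ∈ Ioo (0:ℝ) (1 / 2)) :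
    HasDerivAt (fun x : ℝ => Real.log (1 / (2 * Real.sin (Real.pi * x))))
      (-(Real.pi * (Real.cos (Real.pi * x) / Real.sin (Real.pi * x)))) x := by
  have hsin := sin_pi_mul_pos hx
  have h1 : HasDerivAt (fun x : ℝ => 2 * Real.sin (Real.pi * x))
      (2 * (Real.cos (Real.pi * x) * (Real.pi * 1))) x :=
    (((hasDerivAt_id x).const_mul Real.pi).sin).const_mul 2
  have h2 := (h1.log (by positivity)).neg
  simp only [one_div, Real.log_inv]
  refine h2.congr_deriv ?_
  field_simp

theorem injOn_log_inv_sin :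
    InjOn (fun x : ℝ => Real.log (1 / (2 * Real.sin (Real.pi * x)))) (Ioo (0:ℝ) (1 / 2)) := by
  intro x hx y hy hxy
  have hpi := Real.pi_pos
  have hsx := sin_pi_mul_pos hx
  have hsy := sin_pi_mul_pos hy
  have h1 := Real.log_injOn_pos (mem_Ioi.2 (by positivity)) (mem_Ioi.2 (by positivity)) hxy
  have h2 : Real.sin (Real.pi * x) = Real.sin (Real.pi * y) := by
    field_simp at h1
    exact h1.symm
  have h3 := Real.injOn_sin ⟨by nlinarith [hx.1], by nlinarith [hx.2]⟩
    ⟨by nlinarith [hy.1], by nlinarith [hy.2]⟩ h2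
  exact mul_left_cancel₀ hpi.ne' h3

theorem hdens_log_inv_sin {x : ℝ} (hx : x ∈ Ioo (0:ℝ) (1 / 2)) :
    hdens (Real.log (1 / (2 * Real.sin (Real.pi * x)))) =
      2 / Real.pi * (Real.sin (Real.pi * x) / Real.cos (Real.pi * x)) := by
  have hs := sin_pi_mul_pos hx
  have hc := cos_pi_mul_pos hx
  have hsq := Real.sin_sq_add_cos_sq (Real.pi * x)
  set S := Real.sin (Real.pi * x)
  set C := Real.cos (Real.pi * x)
  have hlt : -Real.log 2 < Real.log (1 / (2 * S)) := by
    rw [← Real.log_inv]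
    apply Real.log_lt_log (by norm_num)
    rw [lt_div_iff₀ (by positivity)]
    nlinarith
  have hexp : 4 * Real.exp (2 * Real.log (1 / (2 * S))) - 1 = (C / S) ^ 2 := by
    rw [two_mul, Real.exp_add, Real.exp_log (by positivity)]
    field_simp
    linarith
  rw [hdens, if_pos hlt, hexp, ← Real.rpow_natCast, ← Real.rpow_mul (by positivity)]
  norm_num [Real.rpow_neg_one]

theorem mem_image_log_inv_sin {y : ℝ} (hy : -Real.log 2 < y) :
    y ∈ (fun x : ℝ => Real.log (1 / (2 * Real.sin (Real.pi * x)))) '' Ioo (0:ℝ) (1 / 2) := by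
  have hpi := Real.pi_pos
  have hpos : 0 < Real.exp (-y) / 2 := by positivity
  have hlt : Real.exp (-y) / 2 < 1 := by
    have : Real.exp (-y) < Real.exp (Real.log 2) := Real.exp_lt_exp.2 (by linarith)
    rw [Real.exp_log two_pos] at this
    linarith
  refine ⟨Real.arcsin (Real.exp (-y) / 2) / Real.pi,
    ⟨div_pos (Real.arcsin_pos.2 hpos) hpi, ?_⟩, ?_⟩
  · rw [div_lt_iff₀ hpi]
    linarith [Real.arcsin_lt_pi_div_two.2 hlt]
  · simp only
    rw [mul_div_cancel₀ _ hpi.ne', Real.sin_arcsin (by linarith) hlt.le,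
      mul_div_cancel₀ _ two_ne_zero, one_div, ← Real.exp_neg, neg_neg, Real.log_exp]

theorem volume_preimage_inter_reflect {f : ℝ → ℝ} {A : Set ℝ} (hf : Measurable f)
    (hA : MeasurableSet A) (hsymm : ∀ x, f (1 - x) = f x) :
    volume (f ⁻¹' A ∩ Ioo (1 / 2 : ℝ) 1) = volume (f ⁻¹' A ∩ Ioo (0:ℝ) (1 / 2)) := by
  have hreflect : MeasurePreserving (fun x : ℝ => 1 - x) volume volume :=
    Measure.measurePreserving_sub_left volume 1
  rw [← hreflect.measure_preimage ((hf hA).inter measurableSet_Ioo).nullMeasurableSet]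
  congr 1
  ext x
  simp only [mem_preimage, mem_inter_iff, mem_Ioo, hsymm]
  constructor <;> rintro ⟨h, h1, h2⟩ <;> exact ⟨h, by linarith, by linarith⟩

theorem volume_inter_Ioo_split (B : Set ℝ) :
    volume (B ∩ Ioo (0:ℝ) 1) =
      volume (B ∩ Ioo (0:ℝ) (1 / 2)) + volume (B ∩ Ioo (1 / 2 : ℝ) 1) := by
  rw [← measure_inter_add_sdiff (B ∩ Ioo (0:ℝ) 1) (measurableSet_Iio (a := (1 / 2 : ℝ)))]
  congr 1
  · congr 1
    ext x
    simp only [mem_inter_iff, mem_Ioo, mem_Iio]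
    constructor
    · rintro ⟨⟨h, h1, h2⟩, h3⟩
      exact ⟨h, h1, h3⟩
    · rintro ⟨h, h1, h2⟩
      exact ⟨⟨h, h1, by linarith⟩, h2⟩
  · have hset : (B ∩ Ioo (0:ℝ) 1) \ Iio (1 / 2) = B ∩ Ico (1 / 2 : ℝ) 1 := by
      ext x
      simp only [mem_inter_iff, mem_Ioo, mem_Iio, mem_sdiff, mem_Ico, not_lt]
      constructor
      · rintro ⟨⟨h, h1, h2⟩, h3⟩
        exact ⟨h, h3, h2⟩
      · rintro ⟨h, h1, h2⟩
        exact ⟨⟨h, by linarith, h2⟩, h1⟩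
    rw [hset]
    exact measure_congr ((ae_eq_refl B).inter Ioo_ae_eq_Ico.symm)

/-- for every `t ≠ 0` the measure `ν_t` (pushforward under `x ↦ t·x`
of the pushforward `ν` of Lebesgue measure on `(0,1)` under
`x ↦ ln(1/(2 sin πx))`) is absolutely continuous with density
`h_t(x) = (1/|t|)·h(x/t)`. -/
theorem stmt16 (t : ℝ) (ht : t ≠ 0) :
    Measure.map (fun x : ℝ => t * x)
        (Measure.map (fun x : ℝ => Real.log (1 / (2 * Real.sin (Real.pi * x))))
          (volume.restrict (Ioo (0:ℝ) 1))) =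
      volume.withDensity (fun x : ℝ => ENNReal.ofReal ((1 / |t|) * hdens (x / t))) := by
  have hmeas : Measurable fun x : ℝ => Real.log (1 / (2 * Real.sin (Real.pi * x))) := by
    fun_prop
  have hmeas' : Measurable fun x : ℝ => t * Real.log (1 / (2 * Real.sin (Real.pi * x))) :=
    hmeas.const_mul t
  rw [Measure.map_map (measurable_const_mul t) hmeas]
  simp only [Function.comp_def]
  ext A hA
  rw [Measure.map_apply hmeas' hA, Measure.restrict_apply (hmeas' hA), withDensity_apply _ hA,
    volume_inter_Ioo_split, volume_preimage_inter_reflect hmeas' hA, ← two_mul]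
  · refine const_mul_volume_preimage_inter measurableSet_Ioo hA hmeas'
      (fun x hx => (hasDerivAt_log_inv_sin hx).const_mul t)
      (fun x hx y hy h => injOn_log_inv_sin hx hy (mul_left_cancel₀ ht h)) ?_ ?_
    · intro x hx
      have hs := sin_pi_mul_pos hx
      have hc := cos_pi_mul_pos hx
      have hpi := Real.pi_pos
      have ht' := abs_pos.2 ht
      rw [mul_div_cancel_left₀ _ ht, hdens_log_inv_sin hx, ← ENNReal.ofReal_mul (abs_nonneg _),
        abs_mul, abs_neg, abs_of_pos (a := Real.pi * _) (by positivity)]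
      rw [← ENNReal.ofReal_ofNat]
      congr 1
      field_simp
    · intro y hy
      have hle : ¬ -Real.log 2 < y / t := by
        intro h
        obtain ⟨x, hx, hxy⟩ := mem_image_log_inv_sin h
        refine hy ⟨x, hx, ?_⟩
        simp only at hxy ⊢
        rw [hxy, mul_div_cancel₀ _ ht]
      simp [hdens, hle]
  · intro x
    rw [mul_sub, mul_one, Real.sin_pi_sub]
end

section
/- Define h̄:ℝ→ℝ by h̄(x) = 1/√(e^{2x}−1) for x>0 and h̄(x)=0 for x≤0. Then for every n∈ℕ the function x ↦ xⁿ·h̄^{(n)}(x) (where h̄^{(n)} denotes the n-th derivative of h̄ on (0,∞)) has property 𝒲; more precisely, there exist A>1 and t>0 such that |xⁿ·h̄^{(n)}(x)| < A·e^{−x/2} for all x>t and |xⁿ·h̄^{(n)}(x)| < A·x^{−1/2} for all 0<x<t. -/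
open Set

/-- The function `h̄(x) = 1/√(e^{2x}−1)` for `x > 0`, extended by `0`. -/
noncomputable def hbar (x : ℝ) : ℝ :=
  if 0 < x then 1 / Real.sqrt (Real.exp (2 * x) - 1) else 0

lemma hbar_pos {x : ℝ} (hx : 0 < x) : 0 < hbar x := by
  have h : 1 < Real.exp (2 * x) := Real.one_lt_exp_iff.mpr (by linarith)
  rw [hbar, if_pos hx]
  exact one_div_pos.mpr (Real.sqrt_pos.mpr (by linarith))

lemma hbar_sq {x : ℝ} (hx : 0 < x) : hbar x ^ 2 = 1 / (Real.exp (2 * x) - 1) := by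
  have h : 1 < Real.exp (2 * x) := Real.one_lt_exp_iff.mpr (by linarith)
  rw [hbar, if_pos hx, div_pow, Real.sq_sqrt (by linarith), one_pow]

lemma hasDerivAt_hbar {x : ℝ} (hx : 0 < x) :
    HasDerivAt hbar (-(hbar x + hbar x ^ 3)) x := by
  have h : 1 < Real.exp (2 * x) := Real.one_lt_exp_iff.mpr (by linarith)
  have hs : 0 < Real.sqrt (Real.exp (2 * x) - 1) := Real.sqrt_pos.mpr (by linarith)
  have hsq := Real.sq_sqrt (show 0 ≤ Real.exp (2 * x) - 1 by linarith)
  have hd : HasDerivAt (fun y : ℝ => Real.exp (2 * y) - 1) (Real.exp (2 * x) * (2 * 1)) x :=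
    (((hasDerivAt_id x).const_mul 2).exp).sub_const 1
  have hinv := (hd.sqrt (by linarith)).fun_inv hs.ne'
  have heq : hbar =ᶠ[nhds x] fun y => (Real.sqrt (Real.exp (2 * y) - 1))⁻¹ := by
    filter_upwards [lt_mem_nhds hx] with y hy
    rw [hbar, if_pos hy, one_div]
  refine (hinv.congr_of_eventuallyEq heq).congr_deriv ?_
  rw [hbar, if_pos hx]
  generalize Real.sqrt (Real.exp (2 * x) - 1) = s at hs hsq
  have he : Real.exp (2 * x) = s ^ 2 + 1 := by linarith
  rw [he]
  field_simp

lemma iteratedDeriv_hbar_eq_eval (n : ℕ) :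
    ∃ Q : Polynomial ℝ, Q.natDegree ≤ 2 * n ∧
      ∀ x : ℝ, 0 < x → iteratedDeriv n hbar x = hbar x * Q.eval (hbar x) := by
  induction n with
  | zero => exact ⟨1, by simp, by simp⟩
  | succ n ih =>
    obtain ⟨Q, hQ, hQe⟩ := ih
    refine ⟨-(1 + Polynomial.X ^ 2) * Polynomial.derivative (Polynomial.X * Q), ?_, ?_⟩
    · have h₁ : (-(1 + Polynomial.X ^ 2) : Polynomial ℝ).natDegree ≤ 2 := by compute_degree
      have h₂ : (Polynomial.X * Q).natDegree ≤ 1 + 2 * n :=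
        Polynomial.natDegree_mul_le_of_le Polynomial.natDegree_X_le hQ
      have h₃ := Polynomial.natDegree_derivative_le (Polynomial.X * Q)
      have h₄ := Polynomial.natDegree_mul_le_of_le h₁ h₃
      omega
    · intro x hx
      have heq : iteratedDeriv n hbar =ᶠ[nhds x]
          fun y => (Polynomial.X * Q).eval (hbar y) := by
        filter_upwards [lt_mem_nhds hx] with y hy
        simp [hQe y hy]
      have hd : HasDerivAt (fun y => (Polynomial.X * Q).eval (hbar y)) _ x :=
        ((Polynomial.X * Q).hasDerivAt (hbar x)).comp x (hasDerivAt_hbar hx)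
      rw [iteratedDeriv_succ, heq.deriv_eq, hd.deriv, Polynomial.eval_mul]
      simp only [Polynomial.eval_neg, Polynomial.eval_add, Polynomial.eval_one,
        Polynomial.eval_pow, Polynomial.eval_X]
      ring

lemma Polynomial.exists_abs_eval_le (Q : Polynomial ℝ) {m : ℕ} (hm : Q.natDegree ≤ m) :
    ∃ C : ℝ, 0 ≤ C ∧ ∀ y : ℝ, 0 ≤ y → |Q.eval y| ≤ C * (1 + y ^ m) := by
  refine ⟨∑ i ∈ Finset.range (m + 1), |Q.coeff i|,
    Finset.sum_nonneg fun i _ => abs_nonneg _, fun y hy => ?_⟩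
  rw [Polynomial.eval_eq_sum_range' (Nat.lt_succ_of_le hm), Finset.sum_mul]
  refine (Finset.abs_sum_le_sum_abs _ _).trans (Finset.sum_le_sum fun i hi => ?_)
  rw [abs_mul, abs_of_nonneg (pow_nonneg hy i)]
  refine mul_le_mul_of_nonneg_left ?_ (abs_nonneg _)
  have hy' := pow_nonneg hy m
  rcases le_total y 1 with h | h
  · linarith [pow_le_one₀ (n := i) hy h]
  · linarith [pow_le_pow_right₀ h (Nat.lt_succ_iff.mp (Finset.mem_range.mp hi))]

lemma exists_abs_iteratedDeriv_hbar_le (n : ℕ) :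
    ∃ C : ℝ, 0 ≤ C ∧ ∀ x : ℝ, 0 < x →
      |x ^ n * iteratedDeriv n hbar x| ≤ C * (x ^ n * (hbar x * (1 + hbar x ^ (2 * n)))) := by
  obtain ⟨Q, hQ, hQe⟩ := iteratedDeriv_hbar_eq_eval n
  obtain ⟨C, hC, hCe⟩ := Q.exists_abs_eval_le hQ
  refine ⟨C, hC, fun x hx => ?_⟩
  have hh := hbar_pos hx
  rw [hQe x hx, abs_mul, abs_mul, abs_of_pos hh, abs_of_pos (pow_pos hx n)]
  calc x ^ n * (hbar x * |Q.eval (hbar x)|)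
      ≤ x ^ n * (hbar x * (C * (1 + hbar x ^ (2 * n)))) := by
        gcongr
        exact hCe _ hh.le
    _ = _ := by ring

lemma hbar_le_rpow {x : ℝ} (hx : 0 < x) : hbar x ≤ x ^ (-(1 : ℝ) / 2) := by
  have h := Real.add_one_le_exp (2 * x)
  rw [hbar, if_pos hx, neg_div, Real.rpow_neg hx.le, ← Real.sqrt_eq_rpow, ← one_div]
  exact one_div_le_one_div_of_le (Real.sqrt_pos.mpr hx) (Real.sqrt_le_sqrt (by linarith))

lemma mul_hbar_sq_le_one {x : ℝ} (hx : 0 < x) : x * hbar x ^ 2 ≤ 1 := by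
  have h := Real.add_one_le_exp (2 * x)
  rw [hbar_sq hx, mul_one_div, div_le_one (by linarith)]
  linarith

lemma hbar_le_exp_neg {x : ℝ} (hx : 1 < x) : hbar x ≤ 2 * Real.exp (-x) := by
  have h := Real.add_one_le_exp (2 * x)
  have hx₀ : 0 < x := by linarith
  have he : Real.exp (2 * x) = Real.exp x ^ 2 := by rw [two_mul, Real.exp_add, sq]
  have hs : Real.exp x / 2 ≤ Real.sqrt (Real.exp (2 * x) - 1) :=
    Real.le_sqrt_of_sq_le (by rw [div_pow, ← he]; linarith)
  rw [hbar, if_pos hx₀]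
  calc 1 / Real.sqrt (Real.exp (2 * x) - 1) ≤ 1 / (Real.exp x / 2) :=
        one_div_le_one_div_of_le (by positivity) hs
    _ = 2 * Real.exp (-x) := by rw [Real.exp_neg]; field_simp

lemma pow_mul_hbar_le_rpow (n : ℕ) {x : ℝ} (hx : 0 < x) (hx' : x < 1) :
    x ^ n * (hbar x * (1 + hbar x ^ (2 * n))) ≤ 2 * x ^ (-(1 : ℝ) / 2) := by
  have hh := hbar_pos hx
  have h₁ : x ^ n ≤ 1 := pow_le_one₀ hx.le hx'.le
  have h₂ : (x * hbar x ^ 2) ^ n ≤ 1 := pow_le_one₀ (by positivity) (mul_hbar_sq_le_one hx)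
  calc x ^ n * (hbar x * (1 + hbar x ^ (2 * n)))
      = hbar x * (x ^ n + (x * hbar x ^ 2) ^ n) := by rw [mul_pow, ← pow_mul]; ring
    _ ≤ hbar x * 2 := by gcongr; linarith
    _ ≤ 2 * x ^ (-(1 : ℝ) / 2) := by linarith [hbar_le_rpow hx]

lemma pow_mul_hbar_le_exp (n : ℕ) {x : ℝ} (hx : 1 < x) :
    x ^ n * (hbar x * (1 + hbar x ^ (2 * n))) ≤
      4 * (2 ^ n * n.factorial) * Real.exp (-x / 2) := by
  have hx₀ : 0 < x := by linarith
  have hh := hbar_pos hx₀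
  have hh₁ : hbar x ≤ 1 := by
    nlinarith [mul_hbar_sq_le_one hx₀]
  have h₁ : hbar x ^ (2 * n) ≤ 1 := pow_le_one₀ hh.le hh₁
  have h₂ : x ^ n ≤ 2 ^ n * n.factorial * Real.exp (x / 2) := by
    have h := Real.pow_div_factorial_le_exp (x / 2) (by positivity) n
    rw [div_pow, div_div, div_le_iff₀ (by positivity)] at h
    linarith
  calc x ^ n * (hbar x * (1 + hbar x ^ (2 * n)))
      ≤ (2 ^ n * n.factorial * Real.exp (x / 2)) * ((2 * Real.exp (-x)) * 2) := by
        gcongr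
        · exact hbar_le_exp_neg hx
        · linarith
    _ = 4 * (2 ^ n * n.factorial) * (Real.exp (x / 2) * Real.exp (-x)) := by ring
    _ = _ := by rw [← Real.exp_add]; ring_nf

lemma iteratedDeriv_hbar_of_neg (n : ℕ) {x : ℝ} (hx : x < 0) : iteratedDeriv n hbar x = 0 := by
  have heq : hbar =ᶠ[nhds x] fun _ => (0 : ℝ) := by
    filter_upwards [gt_mem_nhds hx] with y hy
    rw [hbar, if_neg hy.le.not_gt]
  rw [heq.iteratedDeriv_eq n]
  simp

/-- for every `n`, the function `x ↦ xⁿ·h̄^{(n)}(x)` has property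
`𝒲`; more precisely there are `A > 1` and `t > 0` with
`|xⁿ·h̄^{(n)}(x)| < A·e^{−x/2}` for `x > t` and `|xⁿ·h̄^{(n)}(x)| < A·x^{−1/2}`
for `0 < x < t`. -/
theorem stmt18 (n : ℕ) :
    PropW (fun x : ℝ => x ^ n * iteratedDeriv n hbar x) ∧
    ∃ A : ℝ, 1 < A ∧ ∃ t : ℝ, 0 < t ∧
      (∀ x : ℝ, t < x → |x ^ n * iteratedDeriv n hbar x| < A * Real.exp (-x / 2)) ∧
      (∀ x : ℝ, 0 < x → x < t → |x ^ n * iteratedDeriv n hbar x| < A * x ^ (-(1:ℝ) / 2)) := by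
  obtain ⟨C, hC, hb⟩ := exists_abs_iteratedDeriv_hbar_le n
  set K : ℝ := 4 * (2 ^ n * n.factorial) with hK_def
  have hK : 0 < K := by positivity
  set A : ℝ := C * (K + 2) + 2 with hA_def
  have hCK : 0 ≤ C * K := by positivity
  have hA : 2 ≤ A := by linarith [mul_nonneg hC (by positivity : 0 ≤ K + 2)]
  have large : ∀ x : ℝ, 1 < x →
      |x ^ n * iteratedDeriv n hbar x| < A * Real.exp (-x / 2) := fun x hx =>
    calc _ ≤ C * (K * Real.exp (-x / 2)) :=
          (hb x (by linarith)).trans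
            (mul_le_mul_of_nonneg_left (pow_mul_hbar_le_exp n hx) hC)
      _ = (C * K) * Real.exp (-x / 2) := by ring
      _ < A * Real.exp (-x / 2) := by gcongr; linarith
  have small : ∀ x : ℝ, 0 < x → x < 1 →
      |x ^ n * iteratedDeriv n hbar x| < A * x ^ (-(1:ℝ) / 2) := fun x hx hx' =>
    calc _ ≤ C * (2 * x ^ (-(1:ℝ) / 2)) :=
          (hb x hx).trans (mul_le_mul_of_nonneg_left (pow_mul_hbar_le_rpow n hx hx') hC)
      _ = (C * 2) * x ^ (-(1:ℝ) / 2) := by ring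
      _ < A * x ^ (-(1:ℝ) / 2) := by gcongr; linarith
  refine ⟨⟨A, by linarith, 1, zero_le_one, -(1:ℝ) / 2, by norm_num, fun x hx => ?_,
    fun x hx hx' => ?_⟩, A, by linarith, 1, one_pos, large, small⟩
  · rcases lt_or_ge x 0 with h | h
    · simp only [iteratedDeriv_hbar_of_neg n h, mul_zero, abs_zero]
      positivity
    · rw [abs_of_nonneg h] at hx ⊢
      refine (large x hx).trans_le ?_
      have hle : -x / 2 ≤ -x / A := by
        rw [neg_div, neg_div]
        exact neg_le_neg (div_le_div_of_nonneg_left h two_pos hA)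
      gcongr
  · rcases lt_or_ge x 0 with h | h
    · simp only [iteratedDeriv_hbar_of_neg n h, mul_zero, abs_zero]
      positivity
    · rw [abs_of_nonneg h] at hx hx' ⊢
      exact small x hx hx'
end

section
/- For real numbers x₁,x₂,x₃ define m₁ = x₁+x₂+x₃, p₃ = 5(x₁³+x₂³+x₃³) − (x₁x₂²+x₂x₁²+x₁x₃²+x₃x₁²+x₂x₃²+x₃x₂²) − 2·x₁x₂x₃, and p₅ = −399(x₁⁵+x₂⁵+x₃⁵) + 21·∑_{i≠j} x_i⁴x_j + 10·∑_{i≠j} x_i³x_j² + 20·(x₁³x₂x₃+x₂³x₁x₃+x₃³x₁x₂) − 2·(x₁²x₂²x₃+x₁²x₃²x₂+x₂²x₃²x₁). Suppose x₁,x₂,x₃ and y₁,y₂,y₃ are real numbers with (x₁+x₂)(x₁+x₃)(x₂+x₃) ≠ 0, such that m₁(x)=m₁(y), p₃(x)=p₃(y) and p₅(x)=p₅(y). Then the multisets {x₁,x₂,x₃} and {y₁,y₂,y₃} are equal. -/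
/-- Triples with the same elementary symmetric polynomials agree as multisets. -/
theorem multiset_eq_of_esymm_eq {R : Type*} [CommRing R] [IsDomain R] {x₁ x₂ x₃ y₁ y₂ y₃ : R}
    (h1 : x₁ + x₂ + x₃ = y₁ + y₂ + y₃)
    (h2 : x₁ * x₂ + x₁ * x₃ + x₂ * x₃ = y₁ * y₂ + y₁ * y₃ + y₂ * y₃)
    (h3 : x₁ * x₂ * x₃ = y₁ * y₂ * y₃) :
    ({x₁, x₂, x₃} : Multiset R) = {y₁, y₂, y₃} := by
  open Polynomial in
  have hprod : (({x₁, x₂, x₃} : Multiset R).map fun a => X - C a).prod =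
      (({y₁, y₂, y₃} : Multiset R).map fun a => X - C a).prod := by
    have h1' := congrArg (C : R →+* R[X]) h1
    have h2' := congrArg (C : R →+* R[X]) h2
    have h3' := congrArg (C : R →+* R[X]) h3
    simp only [map_add, map_mul] at h1' h2' h3'
    simp only [Multiset.insert_eq_cons, Multiset.map_cons, Multiset.map_singleton,
      Multiset.prod_cons, Multiset.prod_singleton]
    linear_combination -X ^ 2 * h1' + X * h2' - h3'
  simpa only [Polynomial.roots_multiset_prod_X_sub_C] using congrArg Polynomial.roots hprod


/-- the symmetric polynomials `m₁`, `p₃`, `p₅` determine the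
multiset `{x₁,x₂,x₃}` provided `(x₁+x₂)(x₁+x₃)(x₂+x₃) ≠ 0`. -/
theorem stmt19 (x₁ x₂ x₃ y₁ y₂ y₃ : ℝ)
    (hx : (x₁ + x₂) * (x₁ + x₃) * (x₂ + x₃) ≠ 0)
    (hm1 : x₁ + x₂ + x₃ = y₁ + y₂ + y₃)
    (hp3 : 5 * (x₁^3 + x₂^3 + x₃^3) -
        (x₁*x₂^2 + x₂*x₁^2 + x₁*x₃^2 + x₃*x₁^2 + x₂*x₃^2 + x₃*x₂^2) -
        2 * (x₁*x₂*x₃) =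
      5 * (y₁^3 + y₂^3 + y₃^3) -
        (y₁*y₂^2 + y₂*y₁^2 + y₁*y₃^2 + y₃*y₁^2 + y₂*y₃^2 + y₃*y₂^2) -
        2 * (y₁*y₂*y₃))
    (hp5 : -399 * (x₁^5 + x₂^5 + x₃^5) +
        21 * (x₁^4*x₂ + x₁^4*x₃ + x₂^4*x₁ + x₂^4*x₃ + x₃^4*x₁ + x₃^4*x₂) +
        10 * (x₁^3*x₂^2 + x₁^3*x₃^2 + x₂^3*x₁^2 + x₂^3*x₃^2 + x₃^3*x₁^2 + x₃^3*x₂^2) +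
        20 * (x₁^3*x₂*x₃ + x₂^3*x₁*x₃ + x₃^3*x₁*x₂) -
        2 * (x₁^2*x₂^2*x₃ + x₁^2*x₃^2*x₂ + x₂^2*x₃^2*x₁) =
      -399 * (y₁^5 + y₂^5 + y₃^5) +
        21 * (y₁^4*y₂ + y₁^4*y₃ + y₂^4*y₁ + y₂^4*y₃ + y₃^4*y₁ + y₃^4*y₂) +
        10 * (y₁^3*y₂^2 + y₁^3*y₃^2 + y₂^3*y₁^2 + y₂^3*y₃^2 + y₃^3*y₁^2 + y₃^3*y₂^2) +
        20 * (y₁^3*y₂*y₃ + y₂^3*y₁*y₃ + y₃^3*y₁*y₂) -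
        2 * (y₁^2*y₂^2*y₃ + y₁^2*y₃^2*y₂ + y₂^2*y₃^2*y₁)) :
    ({x₁, x₂, x₃} : Multiset ℝ) = {y₁, y₂, y₃} := by
  have hu : (x₁ + x₂) * (x₁ + x₃) * (x₂ + x₃) = (y₁ + y₂) * (y₁ + y₃) * (y₂ + y₃) := by
    linear_combination -(1 / 16) * hp3 + 5 / 16 * congrArg (· ^ 3) hm1
  have h2 : x₁ * x₂ + x₁ * x₃ + x₂ * x₃ = y₁ * y₂ + y₁ * y₃ + y₂ * y₃ := by
    apply mul_left_cancel₀ hx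
    linear_combination -(1 / 2048) * hp5 - 399 / 2048 * congrArg (· ^ 5) hm1 +
      2016 / 2048 * ((x₁ + x₂ + x₃) ^ 2 * hu +
        (y₁ + y₂) * (y₁ + y₃) * (y₂ + y₃) * congrArg (· ^ 2) hm1) -
      (y₁ * y₂ + y₁ * y₃ + y₂ * y₃) * hu
  have h3 : x₁ * x₂ * x₃ = y₁ * y₂ * y₃ := by
    linear_combination (x₁ + x₂ + x₃) * h2 + (y₁ * y₂ + y₁ * y₃ + y₂ * y₃) * hm1 - hu
  exact multiset_eq_of_esymm_eq hm1 h2 h3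
end
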